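/- Fix δ ∈ (1/2, ∞), and for each SNR > 0 let τ*(SNR) be the unique positive minimizer of F (with parameters δ and SNR). Then, as SNR → +∞: (i) 1/τ*(SNR) → +∞; (ii) 1/τ*(SNR)² − (δ − 1/2)·SNR → 0; and (iii) τ*(SNR)·√((δ − 1/2)·SNR) → 1. -/

import Mathlib

open Real

/-- The standard normal tail function `Q(x) = ∫_x^∞ (2π)^{-1/2} e^{-t²/2} dt`. -/
noncomputable def Qfun (x : ℝ) : ℝ :=
  ∫ t in Set.Ioi x, (Real.sqrt (2 * Real.pi))⁻¹ * Real.exp (-t ^ 2 / 2)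

/-- The function `F` from the paper, with parameters `δ` and `SNR`. -/
noncomputable def Ffun (δ SNR τ : ℝ) : ℝ :=
  τ * (δ - 1 / 2) + (1 / SNR) / τ + (τ + 4 / τ) * Qfun (2 / τ)
    - Real.sqrt (2 / Real.pi) * Real.exp (-2 / τ ^ 2)

open MeasureTheory Filter Topology

/-- The standard normal density. -/
noncomputable def normalDensity (x : ℝ) : ℝ :=
  (Real.sqrt (2 * Real.pi))⁻¹ * Real.exp (-x ^ 2 / 2)

lemma normalDensity_nonneg (x : ℝ) : 0 ≤ normalDensity x := by
  unfold normalDensity; positivity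

lemma continuous_normalDensity : Continuous normalDensity := by
  unfold normalDensity; fun_prop

lemma integrable_normalDensity : Integrable normalDensity := by
  have h := (integrable_exp_neg_mul_sq (b := 1 / 2) (by norm_num)).const_mul
    (Real.sqrt (2 * Real.pi))⁻¹
  refine h.congr (Eventually.of_forall fun x => ?_)
  simp only [normalDensity]
  ring_nf

lemma integrable_mul_normalDensity : Integrable fun x => x * normalDensity x := by
  have h := (integrable_mul_exp_neg_mul_sq (b := 1 / 2) (by norm_num)).const_mul
    (Real.sqrt (2 * Real.pi))⁻¹
  refine h.congr (Eventually.of_forall fun x => ?_)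
  simp only [normalDensity]
  ring_nf

lemma hasDerivAt_normalDensity (x : ℝ) :
    HasDerivAt normalDensity (-(x * normalDensity x)) x := by
  have h := ((((hasDerivAt_id x).pow 2).neg.div_const 2).exp).const_mul
    (Real.sqrt (2 * Real.pi))⁻¹
  refine h.congr_deriv ?_
  simp [normalDensity]
  ring

lemma tendsto_pow_mul_normalDensity (n : ℕ) :
    Tendsto (fun x => x ^ n * normalDensity x) atTop (𝓝 0) := by
  refine squeeze_zero' ?_ ?_ (Real.tendsto_pow_mul_exp_neg_atTop_nhds_zero n)
  · filter_upwards [eventually_ge_atTop 0] with x hx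
    have := normalDensity_nonneg x
    positivity
  · filter_upwards [eventually_ge_atTop 2] with x hx
    refine mul_le_mul_of_nonneg_left ?_ (by positivity)
    have hone : 1 ≤ Real.sqrt (2 * Real.pi) := by
      rw [Real.one_le_sqrt]
      linarith [Real.pi_gt_three]
    calc normalDensity x ≤ 1 * Real.exp (-x ^ 2 / 2) :=
          mul_le_mul_of_nonneg_right (inv_le_one_of_one_le₀ hone) (Real.exp_pos _).le
      _ ≤ Real.exp (-x) := by
          rw [one_mul, Real.exp_le_exp]
          nlinarith

lemma Qfun_nonneg (x : ℝ) : 0 ≤ Qfun x :=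
  integral_nonneg normalDensity_nonneg

lemma hasDerivAt_Qfun (x : ℝ) : HasDerivAt Qfun (-normalDensity x) x := by
  have hQ : Qfun = fun y => Qfun 0 - ∫ t in (0 : ℝ)..y, normalDensity t := by
    funext y
    have h := intervalIntegral.integral_interval_add_Ioi
      (integrable_normalDensity.integrableOn (s := Set.Ioi 0))
      (integrable_normalDensity.integrableOn (s := Set.Ioi y))
    change _ + Qfun y = Qfun 0 at h
    linarith
  rw [hQ]
  exact (intervalIntegral.integral_hasDerivAt_right
    (continuous_normalDensity.intervalIntegrable _ _)
    (continuous_normalDensity.stronglyMeasurableAtFilter _ _)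
    continuous_normalDensity.continuousAt).const_sub _

/-- The Mills ratio bound. -/
lemma mul_Qfun_le_normalDensity (x : ℝ) : x * Qfun x ≤ normalDensity x := by
  have hint : ∫ t in Set.Ioi x, t * normalDensity t = normalDensity x := by
    have h := integral_Ioi_of_hasDerivAt_of_tendsto' (a := x)
      (fun t _ => (hasDerivAt_normalDensity t).neg)
      (by simpa using integrable_mul_normalDensity.integrableOn)
      (by simpa using! (tendsto_pow_mul_normalDensity 0).neg)
    simpa using h
  rw [← hint]
  change x * ∫ t in Set.Ioi x, normalDensity t ≤ _
  rw [← integral_const_mul]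
  refine setIntegral_mono_on (integrable_normalDensity.const_mul x).integrableOn
    integrable_mul_normalDensity.integrableOn measurableSet_Ioi fun t ht => ?_
  exact mul_le_mul_of_nonneg_right (le_of_lt ht) (normalDensity_nonneg t)

/-- The part of `deriv (Ffun δ s)` coming from the Gaussian terms, in the variable `x = 2 / τ`. -/
noncomputable def gaussianSlope (x : ℝ) : ℝ :=
  (1 - x ^ 2) * Qfun x + x * normalDensity x

lemma gaussianSlope_nonneg {x : ℝ} (hx : 0 ≤ x) : 0 ≤ gaussianSlope x := by
  have h := mul_le_mul_of_nonneg_left (mul_Qfun_le_normalDensity x) hx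
  have := Qfun_nonneg x
  unfold gaussianSlope
  linarith

lemma sq_mul_gaussianSlope_le {x : ℝ} (hx : 0 ≤ x) :
    x ^ 2 * gaussianSlope x ≤ x ^ 1 * normalDensity x + x ^ 3 * normalDensity x := by
  have h := mul_le_mul_of_nonneg_left (mul_Qfun_le_normalDensity x) hx
  have := mul_nonneg (by positivity : 0 ≤ x ^ 4) (Qfun_nonneg x)
  unfold gaussianSlope
  linarith

lemma tendsto_sq_mul_gaussianSlope :
    Tendsto (fun x => x ^ 2 * gaussianSlope x) atTop (𝓝 0) := by
  refine squeeze_zero' ?_ ?_ (by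
    simpa using (tendsto_pow_mul_normalDensity 1).add (tendsto_pow_mul_normalDensity 3))
  · filter_upwards [eventually_ge_atTop 0] with x hx
    exact mul_nonneg (sq_nonneg x) (gaussianSlope_nonneg hx)
  · filter_upwards [eventually_ge_atTop 0] with x hx
    simpa using sq_mul_gaussianSlope_le hx

lemma sqrt_two_div_pi_mul_exp (τ : ℝ) :
    Real.sqrt (2 / Real.pi) * Real.exp (-2 / τ ^ 2) = 2 * normalDensity (2 / τ) := by
  have hsqrt : Real.sqrt (2 / Real.pi) = 2 * (Real.sqrt (2 * Real.pi))⁻¹ := by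
    rw [Real.sqrt_eq_iff_mul_self_eq (by positivity) (by positivity)]
    have := Real.mul_self_sqrt (by positivity : 0 ≤ 2 * Real.pi)
    have : (Real.sqrt (2 * Real.pi))⁻¹ * (Real.sqrt (2 * Real.pi))⁻¹ = (2 * Real.pi)⁻¹ := by
      rw [← mul_inv, this]
    field_simp at this ⊢
    linarith
  have hexp : -2 / τ ^ 2 = -(2 / τ) ^ 2 / 2 := by ring
  rw [hsqrt, hexp, normalDensity]
  ring

lemma hasDerivAt_Ffun (δ s : ℝ) {τ : ℝ} (hτ : τ ≠ 0) :
    HasDerivAt (Ffun δ s)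
      (δ - 1 / 2 - (1 / s) * (1 / τ) ^ 2 + gaussianSlope (2 / τ)) τ := by
  have hF : Ffun δ s = fun τ => τ * (δ - 1 / 2) + (1 / s) * τ⁻¹
      + (τ + 4 * τ⁻¹) * Qfun (2 * τ⁻¹) - 2 * normalDensity (2 * τ⁻¹) := by
    funext τ
    rw [Ffun, sqrt_two_div_pi_mul_exp]
    simp only [div_eq_mul_inv]
  have hinv := hasDerivAt_inv hτ
  have hx := hinv.const_mul 2
  rw [hF]
  have h := (((hasDerivAt_id τ).mul_const (δ - 1 / 2)).add (hinv.const_mul (1 / s))).add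
    (((hasDerivAt_id τ).add (hinv.const_mul 4)).mul ((hasDerivAt_Qfun _).comp τ hx)) |>.sub
    (((hasDerivAt_normalDensity _).comp τ hx).const_mul 2)
  refine h.congr_deriv ?_
  simp only [gaussianSlope, id, Function.comp, Pi.add_apply, div_eq_mul_inv]
  field_simp
  ring

/-- The first-order condition at a minimizer, solved for `1 / τ ^ 2`. -/
lemma one_div_sq_sub_of_isMin {δ s τ : ℝ} (hs : 0 < s) (hτ : 0 < τ)
    (hmin : ∀ t : ℝ, 0 < t → Ffun δ s τ ≤ Ffun δ s t) :
    1 / τ ^ 2 - (δ - 1 / 2) * s = s * gaussianSlope (2 / τ) := by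
  have hloc : IsLocalMin (Ffun δ s) τ := by
    filter_upwards [lt_mem_nhds hτ] with t ht using hmin t ht
  have h := hloc.hasDerivAt_eq_zero (hasDerivAt_Ffun δ s hτ.ne')
  have h' : s * (δ - 1 / 2 - (1 / s) * (1 / τ) ^ 2 + gaussianSlope (2 / τ)) = 0 := by
    rw [h, mul_zero]
  have hcancel : s * ((1 / s) * (1 / τ) ^ 2) = 1 / τ ^ 2 := by field_simp
  linarith

theorem stmt13 (δ : ℝ) (hδ : 1 / 2 < δ)
    (τs : ℝ → ℝ) (hτs : ∀ s : ℝ, 0 < s → 0 < τs s)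
    (hmin : ∀ s : ℝ, 0 < s → ∀ τ : ℝ, 0 < τ → Ffun δ s (τs s) ≤ Ffun δ s τ) :
    Filter.Tendsto (fun s => 1 / τs s) Filter.atTop Filter.atTop ∧
    Filter.Tendsto (fun s => 1 / (τs s) ^ 2 - (δ - 1 / 2) * s) Filter.atTop (nhds 0) ∧
    Filter.Tendsto (fun s => τs s * Real.sqrt ((δ - 1 / 2) * s)) Filter.atTop (nhds 1) := by
  have ha : 0 < δ - 1 / 2 := by linarith
  have hfoc : ∀ s, 0 < s →
      1 / τs s ^ 2 - (δ - 1 / 2) * s = s * gaussianSlope (2 / τs s) := fun s hs =>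
    one_div_sq_sub_of_isMin hs (hτs s hs) (hmin s hs)
  have hnonneg : ∀ s, 0 < s → 0 ≤ 1 / τs s ^ 2 - (δ - 1 / 2) * s := fun s hs => by
    have := hτs s hs
    rw [hfoc s hs]
    exact mul_nonneg hs.le (gaussianSlope_nonneg (by positivity))
  have hlin : Tendsto (fun s => (δ - 1 / 2) * s) atTop atTop :=
    tendsto_id.const_mul_atTop ha
  have hinv : Tendsto (fun s => 1 / τs s) atTop atTop := by
    refine tendsto_atTop_mono' _ ?_ (Real.tendsto_sqrt_atTop.comp hlin)
    filter_upwards [eventually_gt_atTop 0] with s hs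
    have hpos := hτs s hs
    refine Real.sqrt_le_iff.2 ⟨by positivity, ?_⟩
    rw [one_div_pow]
    linarith [hnonneg s hs]
  have hdiff : Tendsto (fun s => 1 / (τs s) ^ 2 - (δ - 1 / 2) * s) atTop (𝓝 0) := by
    have htwo : Tendsto (fun s => 2 / τs s) atTop atTop := by
      simpa [div_eq_mul_inv] using hinv.const_mul_atTop (zero_lt_two' ℝ)
    have hbound := (tendsto_sq_mul_gaussianSlope.comp htwo).const_mul (1 / (4 * (δ - 1 / 2)))
    rw [mul_zero] at hbound
    refine squeeze_zero' ?_ ?_ hbound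
    · filter_upwards [eventually_gt_atTop 0] with s hs using hnonneg s hs
    · filter_upwards [eventually_gt_atTop 0] with s hs
      have hpos := hτs s hs
      have hle : s ≤ 1 / (4 * (δ - 1 / 2)) * (2 / τs s) ^ 2 := by
        have heq : 1 / (4 * (δ - 1 / 2)) * (2 / τs s) ^ 2 = (1 / τs s ^ 2) / (δ - 1 / 2) := by
          have := ha.ne'
          field_simp
          ring
        rw [heq, le_div_iff₀ ha]
        linarith [hnonneg s hs]
      rw [hfoc s hs]
      have := mul_le_mul_of_nonneg_right hle
        (gaussianSlope_nonneg (by positivity : 0 ≤ 2 / τs s))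
      simpa only [Function.comp, mul_assoc] using this
  refine ⟨hinv, hdiff, ?_⟩
  have hτ : Tendsto τs atTop (𝓝 0) := by
    simpa [Function.comp_def] using tendsto_inv_atTop_zero.comp hinv
  have hlim := ((((hτ.pow 2).mul hdiff).const_sub 1).sqrt)
  simp only [mul_zero, sub_zero, Real.sqrt_one] at hlim
  refine hlim.congr' ?_
  filter_upwards [eventually_gt_atTop 0] with s hs
  have hpos := hτs s hs
  have heq : 1 - τs s ^ 2 * (1 / τs s ^ 2 - (δ - 1 / 2) * s) =
      τs s ^ 2 * ((δ - 1 / 2) * s) := by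
    field_simp
    ring
  rw [heq, Real.sqrt_mul (sq_nonneg _), Real.sqrt_sq hpos.le]
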